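/- Let c_1,...,c_l be real numbers (l >= 2) with associated 2x2 matrix [[alpha, beta],[gamma, delta]] = [[0,-1],[1,0]] * [[c_1,-1],[1,0]] * ... * [[c_l,-1],[1,0]]. Then the signature of the tridiagonal matrix Lambda(c_1,...,c_l) equals the signature of Lambda(c_2,...,c_l) minus sgn(gamma)*sgn(alpha). -/

import Mathlib

open scoped Classical

/-- The `l × l` symmetric tridiagonal matrix with diagonal entries `c 0, ..., c (l-1)`
and sub/super-diagonal entries `1`. -/
def tridiag {l : ℕ} (c : Fin l → ℝ) : Matrix (Fin l) (Fin l) ℝ :=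
  Matrix.of fun i j =>
    if i = j then c i else if (i : ℕ) + 1 = (j : ℕ) ∨ (j : ℕ) + 1 = (i : ℕ) then 1 else 0

/-- The associated `2 × 2` matrix
`A(c_1,...,c_l) = [[0,-1],[1,0]] * [[c_1,-1],[1,0]] * ⋯ * [[c_l,-1],[1,0]]`. -/
def assocMat {l : ℕ} (c : Fin l → ℝ) : Matrix (Fin 2) (Fin 2) ℝ :=
  !![0, -1; 1, 0] * (List.ofFn fun i => !![c i, -1; 1, 0]).prod

/-- The signature of a real symmetric matrix: the number of positive eigenvalues
minus the number of negative eigenvalues. -/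
noncomputable def signature {n : Type*} [Fintype n] [DecidableEq n]
    (M : Matrix n n ℝ) : ℤ :=
  if hM : M.IsHermitian then
    ((Finset.univ.filter fun i => 0 < hM.eigenvalues i).card : ℤ)
      - ((Finset.univ.filter fun i => hM.eigenvalues i < 0).card : ℤ)
  else 0

open QuadraticMap

section Signature

variable {N M : Type*} [AddCommGroup N] [Module ℝ N] [FiniteDimensional ℝ N]
  [AddCommGroup M] [Module ℝ M] [FiniteDimensional ℝ M]

theorem sigPos_comp_le (Q : QuadraticForm ℝ M) {f : N →ₗ[ℝ] M} (hf : Function.Injective f) :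
    sigPos (Q.comp f) ≤ sigPos Q := by
  obtain ⟨V, hV, hpos⟩ := exists_finrank_eq_sigPos_and_posDef (Q.comp f)
  rw [← hV, (Submodule.equivMapOfInjective f hf V).finrank_eq]
  apply le_sigPos_of_posDef
  rintro ⟨_, x, hx, rfl⟩ hne
  refine hpos ⟨x, hx⟩ fun h => hne ?_
  have hx0 : x = 0 := congrArg Subtype.val h
  simp [hx0]

theorem sigPos_add_finrank_le_sigPos_comp (Q : QuadraticForm ℝ M) {f : N →ₗ[ℝ] M}
    (hf : Function.Injective f) :
    sigPos Q + Module.finrank ℝ N ≤ sigPos (Q.comp f) + Module.finrank ℝ M := by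
  obtain ⟨V, hV, hpos⟩ := exists_finrank_eq_sigPos_and_posDef Q
  have hcomap : Module.finrank ℝ (V.comap f) ≤ sigPos (Q.comp f) := by
    apply le_sigPos_of_posDef
    rintro ⟨x, hx⟩ hne
    refine hpos ⟨f x, hx⟩ fun h => hne ?_
    have hx0 : f x = 0 := congrArg Subtype.val h
    simpa using hf (hx0.trans (map_zero f).symm)
  have hmap := (Submodule.equivMapOfInjective f hf (V.comap f)).finrank_eq
  rw [Submodule.map_comap_eq] at hmap
  have hdim := Submodule.finrank_sup_add_finrank_inf_eq (LinearMap.range f) V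
  have hrange := LinearMap.finrank_range_of_inj hf
  have hle := (LinearMap.range f ⊔ V).finrank_le
  omega

end Signature

namespace Matrix.IsHermitian

variable {n : Type*} [Fintype n] [DecidableEq n] {A : Matrix n n ℝ}

theorem equivalent_weightedSumSquares_eigenvalues (hA : A.IsHermitian) :
    Equivalent A.toQuadraticForm' (weightedSumSquares ℝ hA.eigenvalues) := by
  refine Equivalent.symm ⟨⟨UnitaryGroup.toLinearEquiv hA.eigenvectorUnitary, fun x => ?_⟩⟩
  have hdiag : (hA.eigenvectorUnitary : Matrix n n ℝ)ᵀ * A * hA.eigenvectorUnitary =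
      diagonal hA.eigenvalues := by
    have := hA.conjStarAlgAut_star_eigenvectorUnitary
    simpa [Unitary.conjStarAlgAut_apply, star_eq_conjTranspose] using this
  change A.toQuadraticForm' ((hA.eigenvectorUnitary : Matrix n n ℝ) *ᵥ x) = _
  have : A.toQuadraticForm' ((hA.eigenvectorUnitary : Matrix n n ℝ) *ᵥ x) =
      x ⬝ᵥ (diagonal hA.eigenvalues *ᵥ x) := by
    rw [← hdiag, toQuadraticForm', LinearMap.BilinMap.toQuadraticMap_apply,
      toLinearMap₂'_apply', ← mulVec_mulVec, ← mulVec_mulVec, dotProduct_mulVec x,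
      vecMul_transpose]
  rw [this, weightedSumSquares_apply]
  simp only [dotProduct, mulVec_diagonal, smul_eq_mul]
  exact Finset.sum_congr rfl fun i _ => by ring

theorem signature_eq_sigPos_sub_sigNeg (hA : A.IsHermitian) :
    signature A = (sigPos A.toQuadraticForm' : ℤ) - sigNeg A.toQuadraticForm' := by
  have h := hA.equivalent_weightedSumSquares_eigenvalues
  rw [QuadraticForm.sigPos_of_equiv_weightedSumSquares h,
    QuadraticForm.sigNeg_of_equiv_weightedSumSquares h, signature, dif_pos hA]
  simp [Set.ncard_eq_toFinset_card']

theorem sigPos_add_sigNeg_of_det_ne_zero (hA : A.IsHermitian) (hdet : A.det ≠ 0) :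
    sigPos A.toQuadraticForm' + sigNeg A.toQuadraticForm' = Fintype.card n := by
  have h := hA.equivalent_weightedSumSquares_eigenvalues
  rw [QuadraticForm.sigPos_of_equiv_weightedSumSquares h,
    QuadraticForm.sigNeg_of_equiv_weightedSumSquares h, ← Set.ncard_union_eq,
    ← Nat.card_eq_fintype_card, ← Set.ncard_univ]
  · congr 1
    ext i
    have : hA.eigenvalues i ≠ 0 := by
      rw [hA.det_eq_prod_eigenvalues] at hdet
      exact Finset.prod_ne_zero_iff.mp hdet i (Finset.mem_univ i)
    simpa using this.symm.lt_or_gt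
  · exact Set.disjoint_left.mpr fun i hi hi' =>
      lt_asymm (Set.mem_ofPred.mp hi) (Set.mem_ofPred.mp hi')

theorem sigPos_add_sigNeg_lt_of_det_eq_zero (hA : A.IsHermitian) (hdet : A.det = 0) :
    sigPos A.toQuadraticForm' + sigNeg A.toQuadraticForm' < Fintype.card n := by
  have h := hA.equivalent_weightedSumSquares_eigenvalues
  rw [QuadraticForm.sigPos_of_equiv_weightedSumSquares h,
    QuadraticForm.sigNeg_of_equiv_weightedSumSquares h, ← Set.ncard_union_eq,
    ← Nat.card_eq_fintype_card]
  · rw [hA.det_eq_prod_eigenvalues] at hdet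
    obtain ⟨i, -, hi⟩ := Finset.prod_eq_zero_iff.mp hdet
    apply Set.ncard_lt_card
    intro huniv
    have : i ∈ (Set.univ : Set n) := Set.mem_univ i
    rw [← huniv] at this
    simp only [Set.mem_union, Set.mem_ofPred] at this
    exact this.elim (fun h => h.ne' hi) (fun h => h.ne hi)
  · exact Set.disjoint_left.mpr fun i hi hi' =>
      lt_asymm (Set.mem_ofPred.mp hi) (Set.mem_ofPred.mp hi')

theorem sign_det (hA : A.IsHermitian) (hdet : A.det ≠ 0) :
    Real.sign A.det = (-1) ^ sigNeg A.toQuadraticForm' := by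
  rw [QuadraticForm.sigNeg_of_equiv_weightedSumSquares
    hA.equivalent_weightedSumSquares_eigenvalues]
  have hdet' : A.det = ∏ i, hA.eigenvalues i := hA.det_eq_prod_eigenvalues
  have hne : ∀ i, hA.eigenvalues i ≠ 0 := fun i =>
    Finset.prod_ne_zero_iff.mp (hdet' ▸ hdet) i (Finset.mem_univ i)
  have hfactor : A.det = (∏ i, |hA.eigenvalues i|) *
      (-1) ^ {i | hA.eigenvalues i < 0}.ncard := by
    rw [hdet', Set.ncard_eq_toFinset_card', Set.toFinset_ofPred, ← Finset.prod_const,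
      Finset.prod_filter, ← Finset.prod_mul_distrib]
    refine Finset.prod_congr rfl fun i _ => ?_
    split_ifs with hi
    · simp [abs_of_neg hi]
    · simp [abs_of_nonneg (not_lt.mp hi)]
  have hpos : 0 < ∏ i, |hA.eigenvalues i| :=
    Finset.prod_pos fun i _ => abs_pos.mpr (hne i)
  rcases neg_one_pow_eq_or ℝ {i | hA.eigenvalues i < 0}.ncard with h | h
  · rw [hfactor, h, mul_one, Real.sign_of_pos hpos]
  · rw [hfactor, h, mul_neg_one, Real.sign_of_neg (neg_neg_of_pos hpos)]

/-- If a symmetric matrix and the principal submatrix omitting its first row and column are not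
both singular, the signatures differ by the product of the signs of the determinants. -/
theorem signature_eq_signature_submatrix_succ_add {m : ℕ}
    {A : Matrix (Fin (m + 1)) (Fin (m + 1)) ℝ} (hA : A.IsHermitian)
    (hdet : A.det ≠ 0 ∨ (A.submatrix Fin.succ Fin.succ).det ≠ 0) :
    (signature A : ℝ) = signature (A.submatrix Fin.succ Fin.succ) +
      Real.sign A.det * Real.sign (A.submatrix Fin.succ Fin.succ).det := by
  set B := A.submatrix Fin.succ Fin.succ with hBdef
  have hB : B.IsHermitian := hA.submatrix _
  let f : (Fin m → ℝ) →ₗ[ℝ] (Fin (m + 1) → ℝ) :=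
    { toFun := fun x => Fin.cons (0 : ℝ) x
      map_add' := fun x y => by ext i; refine Fin.cases ?_ (fun i => ?_) i <;> simp
      map_smul' := fun a x => by ext i; refine Fin.cases ?_ (fun i => ?_) i <;> simp }
  have hf : Function.Injective f := Fin.cons_right_injective (α := fun _ => ℝ) 0
  have hcomp : B.toQuadraticForm' = A.toQuadraticForm'.comp f := by
    ext x
    simp [toQuadraticForm', toLinearMap₂'_apply', dotProduct, mulVec, Fin.sum_univ_succ, f, hBdef]
  have hcompneg : -B.toQuadraticForm' = (-A.toQuadraticForm').comp f := by
    ext x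
    simp [hcomp]
  have hposle := sigPos_comp_le A.toQuadraticForm' hf
  have hposge := sigPos_add_finrank_le_sigPos_comp A.toQuadraticForm' hf
  have hnegle := sigPos_comp_le (-A.toQuadraticForm') hf
  have hnegge := sigPos_add_finrank_le_sigPos_comp (-A.toQuadraticForm') hf
  rw [← hcomp] at hposle hposge
  rw [← hcompneg, sigPos_neg, sigPos_neg] at hnegle hnegge
  rw [Module.finrank_fin_fun, Module.finrank_fin_fun] at hposge hnegge
  rw [hA.signature_eq_sigPos_sub_sigNeg, hB.signature_eq_sigPos_sub_sigNeg]
  by_cases hdA : A.det = 0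
  · have hdB := hdet.resolve_left (not_not.mpr hdA)
    have hlt := hA.sigPos_add_sigNeg_lt_of_det_eq_zero hdA
    have heq := hB.sigPos_add_sigNeg_of_det_ne_zero hdB
    rw [Fintype.card_fin] at hlt heq
    rw [hdA, Real.sign_zero, zero_mul, add_zero]
    refine congrArg Int.cast ?_
    omega
  · have heqA := hA.sigPos_add_sigNeg_of_det_ne_zero hdA
    rw [Fintype.card_fin] at heqA
    by_cases hdB : B.det = 0
    · have hlt := hB.sigPos_add_sigNeg_lt_of_det_eq_zero hdB
      rw [Fintype.card_fin] at hlt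
      rw [hdB, Real.sign_zero, mul_zero, add_zero]
      refine congrArg Int.cast ?_
      omega
    · have heqB := hB.sigPos_add_sigNeg_of_det_ne_zero hdB
      rw [Fintype.card_fin] at heqB
      rw [hA.sign_det hdA, hB.sign_det hdB, ← pow_add]
      rcases (by omega : sigNeg A.toQuadraticForm' = sigNeg B.toQuadraticForm' ∨
        sigNeg A.toQuadraticForm' = sigNeg B.toQuadraticForm' + 1) with h | h
      · have hp : sigPos A.toQuadraticForm' = sigPos B.toQuadraticForm' + 1 := by omega
        rw [h, hp, Even.neg_one_pow ⟨_, rfl⟩]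
        push_cast
        ring
      · have hp : sigPos A.toQuadraticForm' = sigPos B.toQuadraticForm' := by omega
        rw [h, hp, Odd.neg_one_pow ⟨sigNeg B.toQuadraticForm', by ring⟩]
        push_cast
        ring

end Matrix.IsHermitian

theorem tridiag_isHermitian {l : ℕ} (c : Fin l → ℝ) : (tridiag c).IsHermitian := by
  ext i j
  simp only [tridiag, Matrix.conjTranspose_apply, Matrix.of_apply, star_trivial]
  by_cases h : i = j
  · simp [h]
  · simp [h, Ne.symm h, or_comm]

theorem tridiag_submatrix_succ {l : ℕ} (c : Fin (l + 1) → ℝ) :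
    (tridiag c).submatrix Fin.succ Fin.succ = tridiag fun i => c i.succ := by
  ext i j
  simp [tridiag]

theorem det_tridiag_succ_succ {l : ℕ} (c : Fin (l + 2) → ℝ) :
    (tridiag c).det = c 0 * (tridiag fun i => c i.succ).det -
      (tridiag fun i => c i.succ.succ).det := by
  have hminor : ((tridiag c).submatrix Fin.succ (Fin.succAbove 1)).det =
      (tridiag fun i => c i.succ.succ).det := by
    rw [Matrix.det_succ_column_zero, Fin.sum_univ_succ, Finset.sum_eq_zero, add_zero]
    · have hsub : ((tridiag c).submatrix Fin.succ (Fin.succAbove 1)).submatrix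
          (Fin.succAbove 0) Fin.succ = tridiag fun i => c i.succ.succ := by
        ext i j
        simp [tridiag]
      rw [hsub]
      simp [tridiag]
    · intro i _
      simp [tridiag, Fin.ext_iff]
  rw [Matrix.det_succ_row_zero, Fin.sum_univ_succ, Fin.sum_univ_succ, Finset.sum_eq_zero]
  · rw [Fin.succ_zero_eq_one, hminor, Fin.succAbove_zero, tridiag_submatrix_succ]
    simp [tridiag]
    ring
  · intro i _
    simp [tridiag, Fin.ext_iff]

theorem det_tridiag_ne_zero_or {l : ℕ} (c : Fin (l + 1) → ℝ) :
    (tridiag c).det ≠ 0 ∨ (tridiag fun i => c i.succ).det ≠ 0 := by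
  induction l with
  | zero => right; simp
  | succ l ih =>
    rcases ih (fun i => c i.succ) with h | h
    · exact Or.inr h
    · by_contra! hzero
      rw [det_tridiag_succ_succ, hzero.2] at hzero
      simp_all

theorem prod_ofFn_apply_zero {l : ℕ} (c : Fin (l + 1) → ℝ) :
    (List.ofFn fun i => !![c i, -1; 1, 0]).prod 0 0 = (tridiag c).det ∧
      (List.ofFn fun i => !![c i, -1; 1, 0]).prod 1 0 = (tridiag fun i => c i.succ).det := by
  induction l with
  | zero => simp [tridiag]
  | succ l ih =>
    obtain ⟨h0, h1⟩ := ih fun i => c i.succ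
    rw [List.ofFn_succ, List.prod_cons]
    simp only [Matrix.mul_apply, Fin.sum_univ_two, h0, h1, det_tridiag_succ_succ c]
    simp
    ring

/-- Recursive formula for the signature of a tridiagonal matrix, removing the
first diagonal entry: `ζ(Λ(c_1,...,c_l)) = ζ(Λ(c_2,...,c_l)) - sgn(γ) sgn(α)`,
where `[[α,β],[γ,δ]]` is the `2 × 2` matrix associated to `(c_1,...,c_l)`. -/
theorem signature_tridiag_drop_first {l : ℕ} (hl : 2 ≤ l) (c : Fin l → ℝ) :
    (signature (tridiag c) : ℝ) =
      (signature (tridiag fun i : Fin (l - 1) =>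
          c ⟨(i : ℕ) + 1, by have := i.isLt; omega⟩) : ℝ)
        - Real.sign (assocMat c 1 0) * Real.sign (assocMat c 0 0) := by
  obtain ⟨m, rfl⟩ : ∃ m, l = m + 1 := ⟨l - 1, by omega⟩
  obtain ⟨h0, h1⟩ := prod_ofFn_apply_zero c
  have hγ : assocMat c 1 0 = (tridiag c).det := by
    rw [assocMat, Matrix.mul_apply, Fin.sum_univ_two, h0, h1]
    simp
  have hα : assocMat c 0 0 = -(tridiag fun i => c i.succ).det := by
    rw [assocMat, Matrix.mul_apply, Fin.sum_univ_two, h0, h1]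
    simp
  have hmain := (tridiag_isHermitian c).signature_eq_signature_submatrix_succ_add (by
    rw [tridiag_submatrix_succ]; exact det_tridiag_ne_zero_or c)
  rw [tridiag_submatrix_succ] at hmain
  rw [hγ, hα, Real.sign_neg, mul_neg, sub_neg_eq_add]
  exact hmain
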